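/- For every γ > 0, t > 0 and x ∈ ℝ, ∫_ℝ p(t; x, y) · 2 e^{-2γ|y|} dy = 1, where p(t; x, y) = (1/(2√(2πt))) exp( γ(|x| + |y|) − (γ²/2) t − (x − y)²/(2t) ) + (γ/4) Erfc( (|x| + |y| − γt)/√(2t) ). -/

import Mathlib

open MeasureTheory Real Set

/-- The complementary error function `Erfc`. -/
noncomputable def erfc (x : ℝ) : ℝ :=
  (2 / Real.sqrt Real.pi) * ∫ u in Set.Ioi x, Real.exp (-u ^ 2)

/-- The transition density `p(t; x, y)`, with respect to the speed measure
`m(dy) = 2 e^{-2γ|y|} dy`, of a Brownian motion with constant drift `γ` towards the origin. -/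
noncomputable def transDensity (γ t x y : ℝ) : ℝ :=
  (1 / (2 * Real.sqrt (2 * Real.pi * t))) *
      Real.exp (γ * (|x| + |y|) - γ ^ 2 / 2 * t - (x - y) ^ 2 / (2 * t)) +
    (γ / 4) * erfc ((|x| + |y| - γ * t) / Real.sqrt (2 * t))

open Filter Topology

theorem erfc_aux_int : Integrable (fun u : ℝ => Real.exp (-u ^ 2)) := by
  simpa using integrable_exp_neg_mul_sq (b := 1) one_pos

theorem erfc_aux_nonneg (x : ℝ) : 0 ≤ erfc x := by
  unfold erfc
  have : 0 ≤ ∫ u in Set.Ioi x, Real.exp (-u ^ 2) :=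
    integral_nonneg fun u => (Real.exp_pos _).le
  positivity

theorem erfc_aux_refl (x : ℝ) : erfc x + erfc (-x) = 2 := by
  unfold erfc
  have h1 := integral_comp_neg_Iic x (fun u : ℝ => Real.exp (-u ^ 2))
  have h2 := intervalIntegral.integral_Iic_add_Ioi (b := x)
    erfc_aux_int.integrableOn erfc_aux_int.integrableOn
  have h3 : ∫ u : ℝ, Real.exp (-u ^ 2) = √π := by
    simpa using integral_gaussian 1
  have h4 : 0 < √π := Real.sqrt_pos.2 Real.pi_pos
  simp only [neg_sq] at h1
  rw [← h1, ← mul_add, add_comm, h2, h3]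
  field_simp

theorem erfc_aux_deriv (x : ℝ) :
    HasDerivAt erfc (-(2 / √π) * Real.exp (-x ^ 2)) x := by
  have hc : Continuous (fun u : ℝ => Real.exp (-u ^ 2)) := by fun_prop
  have h : erfc = fun x => (2 / √π) * ((∫ u in Set.Ioi (0:ℝ), Real.exp (-u ^ 2))
      - ∫ u in (0:ℝ)..x, Real.exp (-u ^ 2)) := by
    funext y
    unfold erfc
    rw [← intervalIntegral.integral_interval_add_Ioi (a := 0) (b := y)
      erfc_aux_int.integrableOn erfc_aux_int.integrableOn]
    ring
  rw [h]
  have h1 := intervalIntegral.integral_hasDerivAt_right (hc.intervalIntegrable 0 x)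
    hc.aestronglyMeasurable.stronglyMeasurableAtFilter hc.continuousAt
  refine ((h1.const_sub (∫ u in Set.Ioi (0:ℝ), Real.exp (-u ^ 2))).const_mul (2 / √π)).congr_deriv ?_
  ring

theorem erfc_aux_tendsto : Tendsto erfc atTop (𝓝 0) := by
  have h1 := intervalIntegral_tendsto_integral_Ioi (0:ℝ)
    (erfc_aux_int.integrableOn) tendsto_id
  have h := (h1.const_sub (∫ u in Set.Ioi (0:ℝ), Real.exp (-u ^ 2))).const_mul (2 / √π)
  rw [sub_self, mul_zero] at h
  refine h.congr fun y => ?_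
  unfold erfc
  rw [← intervalIntegral.integral_interval_add_Ioi (a := 0) (b := y)
      erfc_aux_int.integrableOn erfc_aux_int.integrableOn]
  simp

/-- symmetrised integrand -/
noncomputable def symmG (γ t a y : ℝ) : ℝ :=
  1 / √(2 * π * t) * Real.exp (-((y - a + γ * t) / √(2 * t)) ^ 2) +
  (1 / √(2 * π * t) * Real.exp (-((y + a - γ * t) / √(2 * t)) ^ 2)
    + γ * erfc ((y + a - γ * t) / √(2 * t))) * Real.exp (-2 * γ * y)

theorem symmG_nonneg (γ t a y : ℝ) (hγ : 0 < γ) : 0 ≤ symmG γ t a y := by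
  unfold symmG
  have := erfc_aux_nonneg ((y + a - γ * t) / √(2 * t))
  positivity

theorem symmG_deriv (γ t a y : ℝ) (ht : 0 < t) :
    HasDerivAt (fun y => -(1/2) * erfc ((y - a + γ * t) / √(2 * t))
      - (1/2) * (erfc ((y + a - γ * t) / √(2 * t)) * Real.exp (-2 * γ * y)))
      (symmG γ t a y) y := by
  have e1 : HasDerivAt (fun y => (y - a + γ * t) / √(2 * t)) (1 / √(2 * t)) y :=
    (((hasDerivAt_id y).sub_const a).add_const (γ * t)).div_const _
  have e2 : HasDerivAt (fun y => (y + a - γ * t) / √(2 * t)) (1 / √(2 * t)) y :=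
    (((hasDerivAt_id y).add_const a).sub_const (γ * t)).div_const _
  have e3 : HasDerivAt (fun y => Real.exp (-2 * γ * y)) (Real.exp (-2 * γ * y) * (-2 * γ * 1)) y :=
    ((hasDerivAt_id y).const_mul (-2 * γ)).exp
  have d1 := (erfc_aux_deriv _).comp y e1
  have d2 := (erfc_aux_deriv _).comp y e2
  refine ((d1.const_mul (-(1/2))).sub ((d2.mul e3).const_mul (1/2))).congr_deriv ?_
  have hs : √(2 * π * t) = √π * √(2 * t) := by
    rw [← Real.sqrt_mul Real.pi_pos.le]; congr 1; ring
  unfold symmG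
  rw [hs]
  have h4 : 0 < √π := Real.sqrt_pos.2 Real.pi_pos
  have h5 : 0 < √(2 * t) := Real.sqrt_pos.2 (by positivity)
  simp only [Function.comp]
  field_simp
  ring

theorem symmG_tendsto (γ t a : ℝ) (hγ : 0 < γ) (ht : 0 < t) :
    Tendsto (fun y => -(1/2) * erfc ((y - a + γ * t) / √(2 * t))
      - (1/2) * (erfc ((y + a - γ * t) / √(2 * t)) * Real.exp (-2 * γ * y))) atTop (𝓝 0) := by
  have h5 : 0 < √(2 * t) := Real.sqrt_pos.2 (by positivity)
  have e1 : Tendsto (fun y => (y - a + γ * t) / √(2 * t)) atTop atTop :=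
    (tendsto_atTop_add_const_right _ (γ * t)
      (tendsto_atTop_add_const_right _ (-a) tendsto_id)).atTop_div_const h5
  have e2 : Tendsto (fun y => (y + a - γ * t) / √(2 * t)) atTop atTop :=
    (tendsto_atTop_add_const_right _ (-(γ * t))
      (tendsto_atTop_add_const_right _ a tendsto_id)).atTop_div_const h5
  have e3 : Tendsto (fun y => Real.exp (-2 * γ * y)) atTop (𝓝 0) :=
    Real.tendsto_exp_atBot.comp (tendsto_id.const_mul_atTop_of_neg (by linarith))
  have h := ((erfc_aux_tendsto.comp e1).const_mul (-(1/2))).sub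
    (((erfc_aux_tendsto.comp e2).mul e3).const_mul (1/2))
  simp only [mul_zero, sub_zero] at h
  exact h

theorem symmG_integrable (γ t a : ℝ) (hγ : 0 < γ) (ht : 0 < t) :
    IntegrableOn (symmG γ t a) (Ioi 0) :=
  integrableOn_Ioi_deriv_of_nonneg' (fun y _ => symmG_deriv γ t a y ht)
    (fun y _ => symmG_nonneg γ t a y hγ) (symmG_tendsto γ t a hγ ht)

theorem symmG_integral (γ t a : ℝ) (hγ : 0 < γ) (ht : 0 < t) :
    ∫ y in Ioi 0, symmG γ t a y = 1 := by
  rw [integral_Ioi_of_hasDerivAt_of_nonneg' (fun y _ => symmG_deriv γ t a y ht)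
    (fun y _ => symmG_nonneg γ t a y hγ) (symmG_tendsto γ t a hγ ht)]
  have := erfc_aux_refl ((0 - a + γ * t) / √(2 * t))
  rw [show -((0 - a + γ * t) / √(2 * t)) = (0 + a - γ * t) / √(2 * t) by ring] at this
  simp only [mul_zero, Real.exp_zero]
  linarith

theorem transDensity_symm (γ t x y : ℝ) (ht : 0 < t) :
    transDensity γ t x y * (2 * Real.exp (-2 * γ * |y|)) +
    transDensity γ t x (-y) * (2 * Real.exp (-2 * γ * |-y|)) = symmG γ t |x| |y| := by
  have key : ∀ z : ℝ, 1 / (2 * √(2 * π * t)) *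
      Real.exp (γ * (|x| + |y|) - γ ^ 2 / 2 * t - z ^ 2 / (2 * t)) * (2 * Real.exp (-2 * γ * |y|))
      = 1 / √(2 * π * t) * Real.exp (γ * (|x| + |y|) - γ ^ 2 / 2 * t - z ^ 2 / (2 * t)
        + -2 * γ * |y|) := by
    intro z
    rw [Real.exp_add]
    have : 0 < √(2 * π * t) := Real.sqrt_pos.2 (by positivity)
    field_simp
  have hsum : Real.exp (γ * (|x| + |y|) - γ ^ 2 / 2 * t - (x - y) ^ 2 / (2 * t) + -2 * γ * |y|) +
      Real.exp (γ * (|x| + |y|) - γ ^ 2 / 2 * t - (x - -y) ^ 2 / (2 * t) + -2 * γ * |y|) =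
      Real.exp (γ * (|x| + |y|) - γ ^ 2 / 2 * t - (|x| - |y|) ^ 2 / (2 * t) + -2 * γ * |y|) +
      Real.exp (γ * (|x| + |y|) - γ ^ 2 / 2 * t - (|x| + |y|) ^ 2 / (2 * t) + -2 * γ * |y|) := by
    have hx : x = |x| ∨ x = -|x| := by
      rcases abs_choice x with h | h <;> [left; right] <;> linarith
    have hy : y = |y| ∨ y = -|y| := by
      rcases abs_choice y with h | h <;> [left; right] <;> linarith
    have hh : ((x - y) ^ 2 = (|x| - |y|) ^ 2 ∧ (x - -y) ^ 2 = (|x| + |y|) ^ 2) ∨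
      ((x - y) ^ 2 = (|x| + |y|) ^ 2 ∧ (x - -y) ^ 2 = (|x| - |y|) ^ 2) := by
      generalize |x| = a at *
      generalize |y| = b at *
      rcases hx with rfl | rfl <;> rcases hy with rfl | rfl
      · left; constructor <;> ring
      · right; constructor <;> ring
      · right; constructor <;> ring
      · left; constructor <;> ring
    rcases hh with ⟨h1, h2⟩ | ⟨h1, h2⟩
    · rw [h1, h2]
    · rw [h1, h2, add_comm]
  have k1 : γ * (|x| + |y|) - γ ^ 2 / 2 * t - (|x| - |y|) ^ 2 / (2 * t) + -2 * γ * |y|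
      = -((|y| - |x| + γ * t) / √(2 * t)) ^ 2 := by
    rw [div_pow, Real.sq_sqrt (by positivity)]
    field_simp
    ring
  have k2 : γ * (|x| + |y|) - γ ^ 2 / 2 * t - (|x| + |y|) ^ 2 / (2 * t) + -2 * γ * |y|
      = -((|y| + |x| - γ * t) / √(2 * t)) ^ 2 + -2 * γ * |y| := by
    rw [div_pow, Real.sq_sqrt (by positivity)]
    field_simp
    ring
  rw [k1, k2, Real.exp_add (-((|y| + |x| - γ * t) / √(2 * t)) ^ 2)] at hsum
  have s1 := key (x - y)
  have s2 := key (x - -y)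
  unfold transDensity symmG
  rw [abs_neg, add_mul, add_mul, s1, s2, add_comm |y| |x|]
  rw [add_comm |y| |x|] at hsum
  linear_combination (1 / √(2 * π * t)) * hsum

theorem transDensity_nonneg (γ t x y : ℝ) (hγ : 0 < γ) :
    0 ≤ transDensity γ t x y * (2 * Real.exp (-2 * γ * |y|)) := by
  unfold transDensity
  have := erfc_aux_nonneg ((|x| + |y| - γ * t) / √(2 * t))
  positivity

theorem transDensity_cont (γ t x : ℝ) :
    Continuous fun y => transDensity γ t x y * (2 * Real.exp (-2 * γ * |y|)) := by
  have he : Continuous erfc :=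
    continuous_iff_continuousAt.2 fun z => (erfc_aux_deriv z).continuousAt
  unfold transDensity
  fun_prop

/-- `y ↦ p(t; x, y) · 2 e^{-2γ|y|}` is a probability density on `ℝ` for every `x` and `t > 0`. -/
theorem transDensity_integral_eq_one (γ t x : ℝ) (hγ : 0 < γ) (ht : 0 < t) :
    ∫ y : ℝ, transDensity γ t x y * (2 * Real.exp (-2 * γ * |y|)) = 1 := by
  have hG : Integrable (fun y => symmG γ t |x| |y|) := by
    by_contra h
    have h1 := integral_comp_abs (f := symmG γ t |x|)
    rw [integral_undef h, symmG_integral γ t _ hγ ht] at h1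
    norm_num at h1
  have hf : Integrable (fun y => transDensity γ t x y * (2 * Real.exp (-2 * γ * |y|))) := by
    refine hG.mono' (transDensity_cont γ t x).aestronglyMeasurable (ae_of_all _ fun y => ?_)
    rw [Real.norm_of_nonneg (transDensity_nonneg γ t x y hγ), ← transDensity_symm γ t x y ht]
    have := transDensity_nonneg γ t x (-y) hγ
    linarith
  have h1 := integral_comp_abs (f := symmG γ t |x|)
  rw [symmG_integral γ t _ hγ ht] at h1
  simp only [← transDensity_symm γ t x _ ht] at h1
  rw [integral_add hf hf.comp_neg,
    integral_neg_eq_self (fun y => transDensity γ t x y * (2 * Real.exp (-2 * γ * |y|)))] at h1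
  linarith
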